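/- arXiv:2510.15850 — 3 statements merged into one kernel-verified Lean document; each statement's English description precedes it below -/
import Mathlib

section
/- For real numbers l ≤ u and any real x, the double-softplus transformation x̃ := log(1 + exp(x − l)) − log(1 + exp(x − u)) + l satisfies l ≤ x̃ ≤ u; moreover, if l < u then l < x̃ < u. Hence the double-softplus function enforces the elementwise bound constraints l ≤ x̃ ≤ u on a neural network output. -/
/-- The softplus function is strictly increasing. -/
theorem log_one_add_exp_lt {a b : ℝ} (h : a < b) :
    Real.log (1 + Real.exp a) < Real.log (1 + Real.exp b) :=
  Real.log_lt_log (by positivity) (by gcongr)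

/-- The softplus function grows strictly slower than the identity. -/
theorem log_one_add_exp_sub_lt {a b : ℝ} (h : a < b) :
    Real.log (1 + Real.exp b) - Real.log (1 + Real.exp a) < b - a := by
  rw [sub_lt_iff_lt_add, Real.log_lt_iff_lt_exp (by positivity), Real.exp_add,
    Real.exp_log (by positivity), mul_add, ← Real.exp_add, sub_add_cancel, mul_one]
  gcongr
  exact Real.one_lt_exp_iff.mpr (sub_pos.mpr h)

/-- The double-softplus transformation
`x̃ = log(1 + exp(x − l)) − log(1 + exp(x − u)) + l`
enforces the bound constraints `l ≤ x̃ ≤ u`, strictly when `l < u`. -/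
theorem double_softplus_bounds (l u x : ℝ) (hlu : l ≤ u) :
    (l ≤ Real.log (1 + Real.exp (x - l)) - Real.log (1 + Real.exp (x - u)) + l ∧
      Real.log (1 + Real.exp (x - l)) - Real.log (1 + Real.exp (x - u)) + l ≤ u) ∧
    (l < u →
      l < Real.log (1 + Real.exp (x - l)) - Real.log (1 + Real.exp (x - u)) + l ∧
        Real.log (1 + Real.exp (x - l)) - Real.log (1 + Real.exp (x - u)) + l < u) := by
  have strict (h : l < u) :
      l < Real.log (1 + Real.exp (x - l)) - Real.log (1 + Real.exp (x - u)) + l ∧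
        Real.log (1 + Real.exp (x - l)) - Real.log (1 + Real.exp (x - u)) + l < u :=
    ⟨by linarith [log_one_add_exp_lt (sub_lt_sub_left h x)],
      by linarith [log_one_add_exp_sub_lt (sub_lt_sub_left h x)]⟩
  refine ⟨?_, strict⟩
  rcases hlu.eq_or_lt with rfl | h
  · simp
  · exact ⟨(strict h).1.le, (strict h).2.le⟩
end

section
/- Let M > 0, λ ∈ ℝ, and π ∈ ℝ^E with |π_i| ≤ M for every branch i, and assume f̲ ≤ f̄ and p̲ ≤ p̄ componentwise. Let (μ̲, μ̄, z̲, z̄) be the Dual Lagrangian Learning recovery: μ̲ = max(0, π), μ̄ = max(0, −π), z̲ = max(0, c − λe − Bᵀπ), z̄ = max(0, λe + Bᵀπ − c). Then for every feasible point (λ, π, z̲', z̄', μ̲', μ̄', y') of the dual of the economic dispatch LP having the same λ and π, one has f̲ᵀμ̲' − f̄ᵀμ̄' + p̲ᵀz̲' − p̄ᵀz̄' ≤ f̲ᵀμ̲ − f̄ᵀμ̄ + p̲ᵀz̲ − p̄ᵀz̄; that is, the recovery is an optimal completion of (λ, π), maximizing the dual objective among all feasible completions. -/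
open Matrix

/-- Feasibility for the dual of the economic dispatch LP:
`λe + Bᵀπ + z̲ − z̄ = c`, `−π + μ̲ − μ̄ = 0`, `μ̲ + μ̄ + y = M·e`,
`μ̲, μ̄, z̲, z̄, y ≥ 0`. -/
def edDualFeasible {G E : ℕ} (B : Matrix (Fin E) (Fin G) ℝ) (c : Fin G → ℝ) (M : ℝ)
    (lam : ℝ) (π : Fin E → ℝ) (zlo zup : Fin G → ℝ) (mulo muup y : Fin E → ℝ) : Prop :=
  (∀ g, lam + Bᵀ.mulVec π g + zlo g - zup g = c g) ∧
  (∀ i, -π i + mulo i - muup i = 0) ∧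
  (∀ i, mulo i + muup i + y i = M) ∧
  (∀ i, 0 ≤ mulo i) ∧ (∀ i, 0 ≤ muup i) ∧
  (∀ g, 0 ≤ zlo g) ∧ (∀ g, 0 ≤ zup g) ∧ (∀ i, 0 ≤ y i)

/-- If `a ≤ b`, splitting `x - y` into its positive and negative parts maximizes `a * x - b * y`
among all nonnegative `x` and `y` with the same difference. -/
lemma mul_sub_mul_le_posPart_negPart {a b x y : ℝ} (hab : a ≤ b) (hx : 0 ≤ x) (hy : 0 ≤ y) :
    a * x - b * y ≤ a * max 0 (x - y) - b * max 0 (y - x) := by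
  rcases le_total x y with h | h
  · rw [max_eq_left (sub_nonpos.2 h), max_eq_right (sub_nonneg.2 h)]
    nlinarith
  · rw [max_eq_right (sub_nonneg.2 h), max_eq_left (sub_nonpos.2 h)]
    nlinarith

/-- The vector form of `mul_sub_mul_le_posPart_negPart`. -/
lemma dotProduct_sub_dotProduct_le_posPart_negPart {ι : Type*} [Fintype ι] {a b x y : ι → ℝ}
    (hab : ∀ i, a i ≤ b i) (hx : ∀ i, 0 ≤ x i) (hy : ∀ i, 0 ≤ y i) :
    a ⬝ᵥ x - b ⬝ᵥ y ≤
      (a ⬝ᵥ fun i => max 0 (x i - y i)) - b ⬝ᵥ fun i => max 0 (y i - x i) := by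
  simp only [dotProduct, ← Finset.sum_sub_distrib]
  exact Finset.sum_le_sum fun i _ => mul_sub_mul_le_posPart_negPart (hab i) (hx i) (hy i)

/-- The Dual Lagrangian Learning recovery is an optimal completion of `(λ, π)`:
it maximizes the dual objective among all feasible completions. -/
theorem dll_recovery_optimal_completion {G E : ℕ}
    (B : Matrix (Fin E) (Fin G) ℝ) (c : Fin G → ℝ) (M : ℝ) (hM : 0 < M)
    (flo fup : Fin E → ℝ) (plo pup : Fin G → ℝ)
    (hf : ∀ i, flo i ≤ fup i) (hp : ∀ g, plo g ≤ pup g)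
    (lam : ℝ) (π : Fin E → ℝ) (hπ : ∀ i, |π i| ≤ M)
    (mulo muup : Fin E → ℝ) (zlo zup : Fin G → ℝ)
    (hmulo : mulo = fun i => max 0 (π i))
    (hmuup : muup = fun i => max 0 (-π i))
    (hzlo : zlo = fun g => max 0 (c g - lam - Bᵀ.mulVec π g))
    (hzup : zup = fun g => max 0 (lam + Bᵀ.mulVec π g - c g)) :
    ∀ zlo' zup' : Fin G → ℝ, ∀ mulo' muup' y' : Fin E → ℝ,
      edDualFeasible B c M lam π zlo' zup' mulo' muup' y' →
      flo ⬝ᵥ mulo' - fup ⬝ᵥ muup' + plo ⬝ᵥ zlo' - pup ⬝ᵥ zup' ≤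
        flo ⬝ᵥ mulo - fup ⬝ᵥ muup + plo ⬝ᵥ zlo - pup ⬝ᵥ zup := by
  rintro zlo' zup' mulo' muup' y' ⟨hz, hmu, -, hmulo', hmuup', hzlo', hzup', -⟩
  have hmulo_eq : mulo = fun i => max 0 (mulo' i - muup' i) := by
    rw [hmulo]; funext i; congr 1; linarith [hmu i]
  have hmuup_eq : muup = fun i => max 0 (muup' i - mulo' i) := by
    rw [hmuup]; funext i; congr 1; linarith [hmu i]
  have hzlo_eq : zlo = fun g => max 0 (zlo' g - zup' g) := by
    rw [hzlo]; funext g; congr 1; linarith [hz g]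
  have hzup_eq : zup = fun g => max 0 (zup' g - zlo' g) := by
    rw [hzup]; funext g; congr 1; linarith [hz g]
  rw [hmulo_eq, hmuup_eq, hzlo_eq, hzup_eq]
  linarith [dotProduct_sub_dotProduct_le_posPart_negPart hf hmulo' hmuup',
    dotProduct_sub_dotProduct_le_posPart_negPart hp hzlo' hzup']
end

section
/- Assume M ≥ 0 and let C be a subset of the branch index set {1, …, E}. Suppose (p*, f*, ξ*) is feasible for the relaxed economic dispatch LP with lazy set C and minimizes cᵀp + M·eᵀξ over all feasible points of that relaxed LP. Define f̃ := B p* − r and, for each branch i, ξ̃_i := max(max(0, f̃_i − f̄_i), max(0, f̲_i − f̃_i)). If ξ̃_i = 0 for every branch i ∉ C (the lazy solver's termination condition, i.e., no violated constraints are added), then (p*, f̃, ξ̃) is feasible for the full economic dispatch LP and minimizes cᵀp + M·eᵀξ over all feasible points of the full economic dispatch LP. -/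
open Matrix Finset

/-- Feasibility for the full economic dispatch LP
`min cᵀp + M·eᵀξ  s.t.  Bp − f = r, eᵀp = T, p̲ ≤ p ≤ p̄, f̲ − ξ ≤ f ≤ f̄ + ξ, ξ ≥ 0`. -/
def edFeasible {G E : ℕ} (B : Matrix (Fin E) (Fin G) ℝ) (r : Fin E → ℝ) (T : ℝ)
    (plo pup : Fin G → ℝ) (flo fup : Fin E → ℝ)
    (p : Fin G → ℝ) (f ξ : Fin E → ℝ) : Prop :=
  (∀ i, B.mulVec p i - f i = r i) ∧
  (∑ g, p g = T) ∧
  (∀ g, plo g ≤ p g ∧ p g ≤ pup g) ∧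
  (∀ i, flo i - ξ i ≤ f i ∧ f i ≤ fup i + ξ i) ∧
  (∀ i, 0 ≤ ξ i)

/-- Feasibility for the relaxed economic dispatch LP with lazy set `C`: the
flow-definition constraints `(Bp − r)ᵢ = fᵢ` are imposed only for `i ∈ C`. -/
def edRelaxedFeasible {G E : ℕ} (B : Matrix (Fin E) (Fin G) ℝ) (r : Fin E → ℝ) (T : ℝ)
    (plo pup : Fin G → ℝ) (flo fup : Fin E → ℝ) (C : Set (Fin E))
    (p : Fin G → ℝ) (f ξ : Fin E → ℝ) : Prop :=
  (∀ i ∈ C, B.mulVec p i - f i = r i) ∧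
  (∑ g, p g = T) ∧
  (∀ g, plo g ≤ p g ∧ p g ≤ pup g) ∧
  (∀ i, flo i - ξ i ≤ f i ∧ f i ≤ fup i + ξ i) ∧
  (∀ i, 0 ≤ ξ i)

/-- If the lazy PTDF solver terminates (no violated thermal constraints outside
the lazy set `C`), then the recovered point is optimal for the full economic
dispatch LP. -/
theorem lazy_ptdf_solver_correct {G E : ℕ}
    (B : Matrix (Fin E) (Fin G) ℝ) (r : Fin E → ℝ) (T : ℝ)
    (plo pup : Fin G → ℝ) (flo fup : Fin E → ℝ)
    (c : Fin G → ℝ) (M : ℝ) (hM : 0 ≤ M)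
    (C : Set (Fin E))
    (pstar : Fin G → ℝ) (fstar ξstar : Fin E → ℝ)
    (hfeas : edRelaxedFeasible B r T plo pup flo fup C pstar fstar ξstar)
    (hopt : ∀ p f ξ, edRelaxedFeasible B r T plo pup flo fup C p f ξ →
      c ⬝ᵥ pstar + M * ∑ i, ξstar i ≤ c ⬝ᵥ p + M * ∑ i, ξ i)
    (ftil : Fin E → ℝ) (hftil : ftil = fun i => B.mulVec pstar i - r i)
    (ξtil : Fin E → ℝ)
    (hξtil : ξtil = fun i => max (max 0 (ftil i - fup i)) (max 0 (flo i - ftil i)))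
    (hterm : ∀ i ∉ C, ξtil i = 0) :
    edFeasible B r T plo pup flo fup pstar ftil ξtil ∧
      ∀ p f ξ, edFeasible B r T plo pup flo fup p f ξ →
        c ⬝ᵥ pstar + M * ∑ i, ξtil i ≤ c ⬝ᵥ p + M * ∑ i, ξ i := by
  obtain ⟨hflow, hsum, hbox, hlim, hnonneg⟩ := hfeas
  have hle : ∀ i, ξtil i ≤ ξstar i := by
    intro i
    by_cases hi : i ∈ C
    · have hf : ftil i = fstar i := by
        have := hflow i hi
        rw [hftil]
        linarith
      have hl := hlim i
      simp only [hξtil, hf]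
      exact max_le (max_le (hnonneg i) (by linarith)) (max_le (hnonneg i) (by linarith))
    · rw [hterm i hi]
      exact hnonneg i
  refine ⟨⟨fun i => by simp [hftil], hsum, hbox, fun i => ?_, fun i => ?_⟩, ?_⟩
  · have hup : ftil i - fup i ≤ ξtil i := by
      rw [hξtil]
      exact (le_max_right _ _).trans (le_max_left _ _)
    have hlo : flo i - ftil i ≤ ξtil i := by
      rw [hξtil]
      exact (le_max_right _ _).trans (le_max_right _ _)
    constructor <;> linarith
  · rw [hξtil]
    exact (le_max_left _ _).trans (le_max_left _ _)
  · rintro p f ξ ⟨hflow', hrest⟩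
    have hbest := hopt p f ξ ⟨fun i _ => hflow' i, hrest⟩
    have hpen : M * ∑ i, ξtil i ≤ M * ∑ i, ξstar i :=
      mul_le_mul_of_nonneg_left (Finset.sum_le_sum fun i _ => hle i) hM
    linarith
end
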